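/- Let λ = (λ_1,…,λ_m) ∈ W^odd and suppose there exists a chain of degree d from the identity coset to λ with d ≤ (1^m) (every coordinate of d at most 1). Then for every k with 1 ≤ k ≤ m one has |{λ_1,…,λ_k} ∩ {1,…,k}| ≥ k − 1. -/

import Mathlib

/-- Roots of `R⁺ \ R_P⁺`: the formal symbols `t_i - t_j`, `t_i + t_j` and `2 t_i`. -/
inductive OddRoot : Type where
  | tminus (i j : ℕ) : OddRoot
  | tplus (i j : ℕ) : OddRoot
  | double (i : ℕ) : OddRoot
deriving DecidableEq

namespace OddRoot

/-- The conditions for a formal symbol to be a root of `R⁺ \ R_P⁺`. -/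
def valid (n m : ℕ) : OddRoot → Prop
  | tminus i j => 1 ≤ i ∧ i ≤ m ∧ i < j ∧ j ≤ n + 1
  | tplus i j => 1 ≤ i ∧ i ≤ m ∧ i < j ∧ j ≤ n + 1
  | double i => 1 ≤ i ∧ i ≤ m

/-- The reflection associated to a root, as a (signed) permutation of the
ground set `{1,…,2n+2}` inside `ℕ`, where `ī = 2n+3-i`. -/
def refl (n : ℕ) : OddRoot → Equiv.Perm ℕ
  | tminus i j => Equiv.swap i j * Equiv.swap (2*n+3-i) (2*n+3-j)
  | tplus i j => Equiv.swap i (2*n+3-j) * Equiv.swap j (2*n+3-i)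
  | double i => Equiv.swap i (2*n+3-i)

/-- The degree vector of a root: `deg α k` is the coefficient of the `k`-th
simple coroot in `α∨`. -/
def deg : OddRoot → ℕ → ℤ
  | tminus i j, k => if i ≤ k ∧ k < j then 1 else 0
  | tplus i j, k => (if i ≤ k then (1:ℤ) else 0) + (if j ≤ k then 1 else 0)
  | double i, k => if i ≤ k then 1 else 0

end OddRoot

/-- The total degree of a chain of roots. -/
def chainDeg (L : List OddRoot) (k : ℕ) : ℤ := (L.map (fun α => α.deg k)).sum

/-- `IsChainTo n m L lam` : the sequence of roots `L = [α₁,…,α_t]` is a chain from the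
identity coset to the tuple `lam`, i.e. each `αᵢ` is in `R⁺ \ R_P⁺` and the composite
`w = s_{α₁} ∘ ⋯ ∘ s_{α_t}` satisfies `w i = lam i` for `1 ≤ i ≤ m`. -/
def IsChainTo (n m : ℕ) (L : List OddRoot) (lam : ℕ → ℕ) : Prop :=
  (∀ α ∈ L, α.valid n m) ∧
  ∀ i ∈ Finset.Icc 1 m, ((L.map (OddRoot.refl n)).prod) i = lam i

/-- `W^odd`: tuples `(lam 1, …, lam m)` of pairwise distinct elements of `{1,…,2n+1}`
with no two entries summing to `2n+3`. -/
def Wodd (n m : ℕ) (lam : ℕ → ℕ) : Prop :=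
  (∀ i ∈ Finset.Icc 1 m, lam i ∈ Finset.Icc 1 (2*n+1)) ∧
  (∀ i ∈ Finset.Icc 1 m, ∀ j ∈ Finset.Icc 1 m, i ≠ j → lam i ≠ lam j) ∧
  (∀ i ∈ Finset.Icc 1 m, ∀ j ∈ Finset.Icc 1 m, lam i + lam j ≠ 2*n+3)

/-- `LamEntry lam k i = Λᵏᵢ`, the `i`-th smallest element of `{lam 1, …, lam k}`. -/
def LamEntry (lam : ℕ → ℕ) (k i : ℕ) : ℕ :=
  (((Finset.Icc 1 k).image lam).sort (· ≤ ·)).getD (i-1) 0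

/-- The Bruhat-type order `λ ⪯ δ`: `Λᵏᵢ ≤ Δᵏᵢ` for all `1 ≤ i ≤ k ≤ m`. -/
def Dominates (m : ℕ) (lam del : ℕ → ℕ) : Prop :=
  ∀ k ∈ Finset.Icc 1 m, ∀ i ∈ Finset.Icc 1 k, LamEntry lam k i ≤ LamEntry del k i

/-- The tuples `δʲ`: `δ¹ = ((m+1)̄ | 2 | 3 | ⋯ | m)` and, for `2 ≤ j ≤ m`,
`δʲ = (j̄ | 2 | ⋯ | j-1 | 1 | j+1 | ⋯ | m)`. -/
def delta (n m j : ℕ) : ℕ → ℕ := fun i =>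
  if j = 1 then (if i = 1 then 2*n+2-m else i)
  else if i = 1 then 2*n+3-j else if i = j then 1 else i

/-- The pattern vector `(0^a 1^b c^(m-a-b))`. -/
def patvec (a b : ℕ) (c : ℤ) : ℕ → ℤ := fun k =>
  if k ≤ a then 0 else if k ≤ a + b then 1 else c

/-- The simple reflections `s_k` (`1 ≤ k ≤ n`, swapping `k ↔ k+1` and `k̄ ↔ (k+1)̄`)
and `s_{n+1}` (swapping `n+1 ↔ (n+1)̄ = n+2`). -/
def simpleRefl (n k : ℕ) : Equiv.Perm ℕ :=
  if k ≤ n then Equiv.swap k (k+1) * Equiv.swap (2*n+3-k) (2*n+2-k)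
  else Equiv.swap (n+1) (n+2)

/-- A reflection moves at most `deg α k` elements of `{1,…,k}` outside of `{1,…,k}`. -/
theorem refl_out_card (n m k : ℕ) (hmn : m ≤ n) (hk : k ≤ m) (α : OddRoot)
    (hα : α.valid n m) :
    ((((Finset.Icc 1 k).image (α.refl n)) \ Finset.Icc 1 k).card : ℤ) ≤ α.deg k := by
  cases α with
  | tminus i j =>
    simp only [OddRoot.valid] at hα
    have hsub : ((Finset.Icc 1 k).image ((OddRoot.tminus i j).refl n)) \ Finset.Icc 1 k ⊆
        if i ≤ k ∧ k < j then {j} else ∅ := by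
      intro x hx
      simp only [Finset.mem_sdiff, Finset.mem_image, Finset.mem_Icc, OddRoot.refl,
        Equiv.Perm.mul_apply] at hx
      obtain ⟨⟨a, ha, rfl⟩, hx⟩ := hx
      rw [Equiv.swap_apply_of_ne_of_ne (a := 2*n+3-i) (by omega) (by omega)] at hx ⊢
      rw [Equiv.swap_apply_def] at hx ⊢
      split_ifs at hx ⊢ <;> simp <;> omega
    have := Finset.card_le_card hsub
    simp only [OddRoot.deg]
    split_ifs at this ⊢ <;> simp at this ⊢ <;> first | exact_mod_cast this | simp [this]
  | tplus i j =>
    simp only [OddRoot.valid] at hα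
    have hsub : ((Finset.Icc 1 k).image ((OddRoot.tplus i j).refl n)) \ Finset.Icc 1 k ⊆
        (if i ≤ k then {2*n+3-j} else ∅) ∪ (if j ≤ k then {2*n+3-i} else ∅) := by
      intro x hx
      simp only [Finset.mem_sdiff, Finset.mem_image, Finset.mem_Icc, OddRoot.refl,
        Equiv.Perm.mul_apply] at hx
      obtain ⟨⟨a, ha, rfl⟩, hx⟩ := hx
      rw [Equiv.swap_apply_def j, Equiv.swap_apply_def] at hx ⊢
      split_ifs at hx ⊢ <;> simp <;> omega
    have h1 := (Finset.card_le_card hsub).trans (Finset.card_union_le _ _)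
    have h2 : ∀ (p : Prop) [Decidable p] (x : ℕ),
        (((if p then {x} else ∅ : Finset ℕ).card : ℕ) : ℤ) = if p then 1 else 0 := by
      intro p _ x
      split_ifs <;> simp
    simp only [OddRoot.deg]
    rw [← h2 (i ≤ k) (2*n+3-j), ← h2 (j ≤ k) (2*n+3-i)]
    exact_mod_cast h1
  | double i =>
    simp only [OddRoot.valid] at hα
    have hsub : ((Finset.Icc 1 k).image ((OddRoot.double i).refl n)) \ Finset.Icc 1 k ⊆
        if i ≤ k then {2*n+3-i} else ∅ := by
      intro x hx
      simp only [Finset.mem_sdiff, Finset.mem_image, Finset.mem_Icc, OddRoot.refl] at hx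
      obtain ⟨⟨a, ha, rfl⟩, hx⟩ := hx
      rw [Equiv.swap_apply_def] at hx ⊢
      split_ifs at hx ⊢ <;> simp <;> omega
    have := Finset.card_le_card hsub
    simp only [OddRoot.deg]
    split_ifs at this ⊢ <;> simp at this ⊢ <;> first | exact_mod_cast this | simp [this]

/-- The number of elements moved out of a set is subadditive under composition. -/
theorem out_card_mul (A : Finset ℕ) (s w : Equiv.Perm ℕ) :
    ((A.image (s * w)) \ A).card ≤ ((A.image s) \ A).card + ((A.image w) \ A).card := by
  have hsub : (A.image (s * w)) \ A ⊆ ((A.image s) \ A) ∪ ((A.image w) \ A).image s := by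
    intro x hx
    simp only [Finset.mem_sdiff, Finset.mem_image, Finset.mem_union,
      Equiv.Perm.mul_apply] at hx ⊢
    obtain ⟨⟨a, ha, rfl⟩, hx⟩ := hx
    by_cases h : w a ∈ A
    · exact Or.inl ⟨⟨w a, h, rfl⟩, hx⟩
    · exact Or.inr ⟨w a, ⟨⟨a, ha, rfl⟩, h⟩, rfl⟩
  refine (Finset.card_le_card hsub).trans ((Finset.card_union_le _ _).trans ?_)
  have := Finset.card_image_le (s := (A.image w) \ A) (f := s)
  omega

/-- A chain moves at most `chainDeg L k` elements of `{1,…,k}` outside of `{1,…,k}`. -/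
theorem chain_out_card (n m k : ℕ) (hmn : m ≤ n) (hk : k ≤ m) (L : List OddRoot)
    (hL : ∀ α ∈ L, α.valid n m) :
    ((((Finset.Icc 1 k).image ((L.map (OddRoot.refl n)).prod)) \ Finset.Icc 1 k).card : ℤ)
      ≤ chainDeg L k := by
  induction L with
  | nil => simp [chainDeg]
  | cons α L ih =>
    have h1 := refl_out_card n m k hmn hk α (hL α (by simp))
    have h2 := ih (fun β hβ => hL β (by simp [hβ]))
    have h3 := out_card_mul (Finset.Icc 1 k) (α.refl n) ((L.map (OddRoot.refl n)).prod)
    have h4 : chainDeg (α :: L) k = α.deg k + chainDeg L k := by simp [chainDeg]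
    rw [h4, List.map_cons, List.prod_cons]
    omega

/-- Lemma `lem:intsec`: if `λ ∈ W^odd` is reached from the identity coset by
a chain of degree `d ≤ (1^m)`, then `|{λ₁,…,λ_k} ∩ {1,…,k}| ≥ k - 1` for all `1 ≤ k ≤ m`. -/
theorem intersection_bound (n m : ℕ) (hn : 1 ≤ n) (hm : 1 ≤ m) (hmn : m ≤ n)
    (lam : ℕ → ℕ) (hlam : Wodd n m lam)
    (L : List OddRoot) (hchain : IsChainTo n m L lam)
    (hdeg : ∀ k ∈ Finset.Icc 1 m, chainDeg L k ≤ 1) :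
    ∀ k ∈ Finset.Icc 1 m,
      (k : ℕ) - 1 ≤ (((Finset.Icc 1 k).image lam) ∩ Finset.Icc 1 k).card := by
  intro k hk
  have hd := hdeg k hk
  rw [Finset.mem_Icc] at hk
  have h1 := chain_out_card n m k hmn hk.2 L hchain.1
  have himg : (Finset.Icc 1 k).image ((L.map (OddRoot.refl n)).prod)
      = (Finset.Icc 1 k).image lam := by
    apply Finset.image_congr
    intro i hi
    simp only [Finset.coe_Icc, Set.mem_Icc] at hi
    exact hchain.2 i (Finset.mem_Icc.2 ⟨hi.1, hi.2.trans hk.2⟩)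
  have hcard : ((Finset.Icc 1 k).image lam).card = k := by
    rw [← himg, Finset.card_image_of_injective _ (Equiv.injective _)]
    simp
  rw [himg] at h1
  have h2 := Finset.card_sdiff_add_card_inter ((Finset.Icc 1 k).image lam) (Finset.Icc 1 k)
  omega
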